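/- arXiv:1809.05642 — 9 statements merged into one kernel-verified Lean document; each statement's English description precedes it below -/
import Mathlib

section
/- The set Φ := {(λ,ω) ∈ ℝ^m × ℝ^n : λ ∈ Γ_cl and V(λ,ω) ≤ c/β} is nonempty and compact for every β > 0; in particular (λ^∞, ω^∞·1_n) ∈ Φ, V(λ^∞, ω^∞·1_n) = 0, and c ≥ 0. -/
open Real BigOperators

/-- The graph of the cosine on `[-π/2, π/2]` lies below its tangent line at any interior point. -/
lemma cos_tangent_gap_nonneg {a x : ℝ} (ha : |a| < π / 2) (hx : |x| ≤ π / 2) :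
    0 ≤ Real.cos a - Real.cos x - x * Real.sin a + a * Real.sin a := by
  have hx' : x ∈ Set.Icc (-(π / 2)) (π / 2) := abs_le.mp hx
  have ha' : a ∈ Set.Icc (-(π / 2)) (π / 2) := abs_le.mp ha.le
  have hconc := strictConcaveOn_cos_Icc.concaveOn
  have hd := Real.hasDerivAt_cos a
  rcases lt_trichotomy a x with h | rfl | h
  · have := hconc.slope_le_of_hasDerivAt ha' hx' h hd
    rw [slope_def_field, div_le_iff₀ (sub_pos.mpr h)] at this
    linarith
  · simp
  · have := hconc.le_slope_of_hasDerivAt hx' ha' h hd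
    rw [slope_def_field, le_div_iff₀ (sub_pos.mpr h)] at this
    linarith

/-- The set `Φ = {(λ,ω) : λ ∈ Γ_cl, V(λ,ω) ≤ c/β}` is nonempty and
compact for every `β > 0`; in particular `(λ∞, ω∞·1) ∈ Φ`, `V(λ∞, ω∞·1) = 0`,
and `c ≥ 0`. -/
theorem Phi_nonempty_compact
    (n m : ℕ) (M E : Fin n → ℝ) (hM : ∀ i, 0 < M i) (hE : ∀ i, 0 < E i)
    (Yb : Fin m → ℝ) (hYb : ∀ j, 0 < Yb j)
    (ωinf : ℝ) (lamInf : Fin m → ℝ) (hlamInf : ∀ j, |lamInf j| < π / 2) :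
    ∀ β > (0 : ℝ),
      letI V : (Fin m → ℝ) → (Fin n → ℝ) → ℝ := fun lam ω =>
        (1 / 2) * ∑ i, M i * (ω i - ωinf) ^ 2
          + ∑ j, Yb j * (Real.cos (lamInf j) - Real.cos (lam j)
              - lam j * Real.sin (lamInf j) + lamInf j * Real.sin (lamInf j))
      letI Γcl : Set (Fin m → ℝ) := {lam | ∀ j, |lam j| ≤ π / 2}
      letI c : ℝ := sInf ((fun lam => V lam (fun _ => ωinf)) '' frontier Γcl)
      letI Φ : Set ((Fin m → ℝ) × (Fin n → ℝ)) :=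
        {x | x.1 ∈ Γcl ∧ V x.1 x.2 ≤ c / β}
      V lamInf (fun _ => ωinf) = 0 ∧ 0 ≤ c ∧
        (lamInf, fun _ => ωinf) ∈ Φ ∧ Φ.Nonempty ∧ IsCompact Φ := by
  intro β hβ
  let V : (Fin m → ℝ) → (Fin n → ℝ) → ℝ := fun lam ω =>
    (1 / 2) * ∑ i, M i * (ω i - ωinf) ^ 2
      + ∑ j, Yb j * (Real.cos (lamInf j) - Real.cos (lam j)
          - lam j * Real.sin (lamInf j) + lamInf j * Real.sin (lamInf j))
  let Γcl : Set (Fin m → ℝ) := {lam | ∀ j, |lam j| ≤ π / 2}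
  let c : ℝ := sInf ((fun lam => V lam (fun _ => ωinf)) '' frontier Γcl)
  let Φ : Set ((Fin m → ℝ) × (Fin n → ℝ)) := {x | x.1 ∈ Γcl ∧ V x.1 x.2 ≤ c / β}
  change V lamInf (fun _ => ωinf) = 0 ∧ 0 ≤ c ∧
    (lamInf, fun _ => ωinf) ∈ Φ ∧ Φ.Nonempty ∧ IsCompact Φ
  have hVc : Continuous fun x : (Fin m → ℝ) × (Fin n → ℝ) => V x.1 x.2 := by
    simp only [V]
    fun_prop
  have hΓ : IsClosed Γcl := by
    simp only [Γcl, Set.ofPred_forall]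
    exact isClosed_iInter fun j => isClosed_le (by fun_prop) continuous_const
  have hpot : ∀ lam ∈ Γcl, 0 ≤ ∑ j, Yb j * (Real.cos (lamInf j) - Real.cos (lam j)
      - lam j * Real.sin (lamInf j) + lamInf j * Real.sin (lamInf j)) := fun lam hlam =>
    Finset.sum_nonneg fun j _ =>
      mul_nonneg (hYb j).le (cos_tangent_gap_nonneg (hlamInf j) (hlam j))
  have hV0 : V lamInf (fun _ => ωinf) = 0 := by simp [V]
  have hc : 0 ≤ c := by
    refine Real.sInf_nonneg ?_
    rintro _ ⟨lam, hlam, rfl⟩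
    simpa [V] using hpot lam (hΓ.frontier_subset hlam)
  have hmem : (lamInf, fun _ => ωinf) ∈ Φ :=
    ⟨fun j => (hlamInf j).le, hV0.trans_le (div_nonneg hc hβ.le)⟩
  refine ⟨hV0, hc, hmem, ⟨_, hmem⟩, ?_⟩
  have hclosed : IsClosed Φ :=
    (hΓ.preimage continuous_fst).inter (isClosed_le hVc continuous_const)
  have hbox : IsCompact
      ((Set.univ.pi fun _ : Fin m => Set.Icc (-(π / 2)) (π / 2)) ×ˢ
        (Set.univ.pi fun i : Fin n => Metric.closedBall ωinf √(2 * (c / β) / M i))) :=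
    (isCompact_univ_pi fun _ => isCompact_Icc).prod
      (isCompact_univ_pi fun _ => isCompact_closedBall _ _)
  refine hbox.of_isClosed_subset hclosed ?_
  rintro ⟨lam, ω⟩ ⟨hlam, hV⟩
  refine ⟨fun j _ => abs_le.mp (hlam j), fun i _ => ?_⟩
  have hterm : M i * (ω i - ωinf) ^ 2 ≤ ∑ i, M i * (ω i - ωinf) ^ 2 :=
    Finset.single_le_sum (f := fun i => M i * (ω i - ωinf) ^ 2)
      (fun k _ => mul_nonneg (hM k).le (sq_nonneg _)) (Finset.mem_univ i)
  have hp := hpot lam hlam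
  simp only [V] at hV
  rw [Metric.mem_closedBall, Real.dist_eq]
  refine Real.abs_le_sqrt ?_
  rw [le_div_iff₀ (hM i)]
  linarith
end

section
/- Let (λ(·), ω(·)) be a differentiable solution on [0,∞) of the closed-loop swing dynamics whose control inputs u_i satisfy, for every i ∈ 𝔠 and every time t, (ω_i(t) − ω^∞)·u_i(λ(t),ω(t),p) ≤ 0. Then for every t ≥ 0 the function t ↦ V(λ(t),ω(t)) is differentiable and d/dt V(λ(t),ω(t)) ≤ −Σ_{i=1}^n E_i(ω_i(t) − ω^∞)² ≤ 0. -/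
open Real BigOperators

/-- An incidence matrix annihilates constants, so `D` may be applied to deviations from any
constant. -/
lemma mulVec_eq_sum_sub_const_of_incidence {m n : ℕ} {D : Matrix (Fin m) (Fin n) ℝ}
    (hD : ∀ k : Fin m, ∃ i j : Fin n, i ≠ j ∧ D k i = 1 ∧ D k j = -1 ∧
      ∀ l, l ≠ i → l ≠ j → D k l = 0) (v : Fin n → ℝ) (c : ℝ) (k : Fin m) :
    D.mulVec v k = ∑ i, D k i * (v i - c) := by
  obtain ⟨i, j, hij, hi, hj, h0⟩ := hD k
  have hrow : ∑ l, D k l = 0 := by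
    rw [Fintype.sum_eq_add i j hij fun l hl => h0 l hl.1 hl.2, hi, hj, add_neg_cancel]
  simp only [mul_sub, Finset.sum_sub_distrib, ← Finset.sum_mul, hrow, zero_mul, sub_zero]
  rfl

/-- Along any differentiable solution of the closed-loop swing dynamics whose
control inputs satisfy `(ω_i − ω∞)·u_i ≤ 0` for all controlled buses, the energy
function `V` is differentiable in time and
`d/dt V(λ(t),ω(t)) ≤ −Σ_i E_i (ω_i(t) − ω∞)² ≤ 0`. -/
theorem energy_nonincreasing
    (n m : ℕ)
    (D : Matrix (Fin m) (Fin n) ℝ)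
    (hD : ∀ k : Fin m, ∃ i j : Fin n, i ≠ j ∧ D k i = 1 ∧ D k j = -1 ∧
      ∀ l, l ≠ i → l ≠ j → D k l = 0)
    (Yb : Fin m → ℝ) (hYb : ∀ j, 0 < Yb j)
    (M E : Fin n → ℝ) (hM : ∀ i, 0 < M i) (hE : ∀ i, 0 < E i)
    (p : Fin n → ℝ) (C : Set (Fin n))
    (u : Fin n → (Fin m → ℝ) → (Fin n → ℝ) → (Fin n → ℝ) → ℝ)
    (hu0 : ∀ i ∉ C, ∀ lam ω q, u i lam ω q = 0)
    (ωinf : ℝ) (hωinf : ωinf = (∑ i, p i) / (∑ i, E i))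
    (lamInf : Fin m → ℝ) (hrange : ∃ θ, D.mulVec θ = lamInf)
    (hbound : ∀ j, |lamInf j| < π / 2)
    (heq : ∀ i, p i - ωinf * E i = ∑ j, D j i * Yb j * Real.sin (lamInf j))
    (lam : ℝ → Fin m → ℝ) (ω : ℝ → Fin n → ℝ) (ωd : ℝ → Fin n → ℝ)
    (hlam : ∀ t ≥ (0 : ℝ), HasDerivAt lam (D.mulVec (ω t)) t)
    (hω : ∀ t ≥ (0 : ℝ), ∀ i, HasDerivAt (fun s => ω s i) (ωd t i) t)
    (hdyn : ∀ t ≥ (0 : ℝ), ∀ i, M i * ωd t i =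
      -E i * ω t i - (∑ j, D j i * Yb j * Real.sin (lam t j)) + p i
        + u i (lam t) (ω t) p)
    (huc : ∀ i ∈ C, ∀ t ≥ (0 : ℝ), (ω t i - ωinf) * u i (lam t) (ω t) p ≤ 0) :
    ∀ t ≥ (0 : ℝ), ∃ d : ℝ,
      HasDerivAt (fun s =>
        (1 / 2) * ∑ i, M i * (ω s i - ωinf) ^ 2
          + ∑ j, Yb j * (Real.cos (lamInf j) - Real.cos (lam s j)
              - lam s j * Real.sin (lamInf j) + lamInf j * Real.sin (lamInf j))) d t
      ∧ d ≤ -∑ i, E i * (ω t i - ωinf) ^ 2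
      ∧ -∑ i, E i * (ω t i - ωinf) ^ 2 ≤ 0 := by
  intro t ht
  have hkin : HasDerivAt (fun s => (1 / 2) * ∑ i, M i * (ω s i - ωinf) ^ 2)
      (∑ i, (ω t i - ωinf) * (M i * ωd t i)) t := by
    refine ((HasDerivAt.fun_sum fun i _ =>
      (((hω t ht i).sub_const ωinf).fun_pow 2).const_mul (M i)).const_mul (1 / 2 : ℝ)).congr_deriv ?_
    rw [Finset.mul_sum]
    refine Finset.sum_congr rfl fun i _ => ?_
    push_cast
    ring
  have hpot : HasDerivAt (fun s => ∑ j, Yb j * (Real.cos (lamInf j) - Real.cos (lam s j)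
      - lam s j * Real.sin (lamInf j) + lamInf j * Real.sin (lamInf j)))
      (∑ j, Yb j * (Real.sin (lam t j) - Real.sin (lamInf j)) * D.mulVec (ω t) j) t := by
    refine HasDerivAt.fun_sum fun j _ => ?_
    have hj := hasDerivAt_pi.1 (hlam t ht) j
    refine ((((hj.cos.const_sub (Real.cos (lamInf j))).fun_sub
      (hj.mul_const (Real.sin (lamInf j)))).add_const
        (lamInf j * Real.sin (lamInf j))).const_mul (Yb j)).congr_deriv ?_
    ring
  refine ⟨_, hkin.fun_add hpot, ?_, ?_⟩
  · have hswap : ∑ j, Yb j * (Real.sin (lam t j) - Real.sin (lamInf j)) * D.mulVec (ω t) j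
        = ∑ i, (ω t i - ωinf) * ((∑ j, D j i * Yb j * Real.sin (lam t j))
            - ∑ j, D j i * Yb j * Real.sin (lamInf j)) := by
      simp only [mulVec_eq_sum_sub_const_of_incidence hD (ω t) ωinf, ← Finset.sum_sub_distrib,
        Finset.mul_sum]
      rw [Finset.sum_comm]
      refine Finset.sum_congr rfl fun i _ => Finset.sum_congr rfl fun j _ => ?_
      ring
    rw [hswap, ← Finset.sum_add_distrib, ← Finset.sum_neg_distrib]
    refine Finset.sum_le_sum fun i _ => ?_
    have hcontrol : (ω t i - ωinf) * u i (lam t) (ω t) p ≤ 0 := by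
      by_cases hi : i ∈ C
      · exact huc i hi t ht
      · rw [hu0 i hi, mul_zero]
    rw [hdyn t ht i, ← heq i]
    linarith
  · exact neg_nonpos.2 (Finset.sum_nonneg fun i _ => mul_nonneg (hE i).le (sq_nonneg _))
end

section
/- Suppose each u_i (i ∈ 𝔠) is locally Lipschitz in (λ,ω) and satisfies for all (λ,ω): (ω_i − ω^∞)·u_i(λ,ω,p) ≤ 0 whenever ω_i ≠ ω^∞, and u_i(λ,ω,p) = 0 whenever ω_i = ω^∞. Let β > 1. Then for every initial condition with λ(0) ∈ range(D) and (λ(0),ω(0)) ∈ Φ, there exists a unique differentiable solution (λ(·),ω(·)) of the closed-loop swing dynamics defined on all of [0,∞) with these initial values. -/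
open Real BigOperators

open Set Metric in
/-- A time-dependent vector field that, on every bounded time interval, is bounded and Lipschitz in
space has a global integral curve through every point. -/
theorem exists_isIntegralCurve_of_lipschitzWith {F : Type*} [NormedAddCommGroup F]
    [NormedSpace ℝ F] [CompleteSpace F] {v : ℝ → F → F}
    (hcont : ∀ x, Continuous fun t => v t x)
    (hv : ∀ N : ℕ, ∃ K L : NNReal, ∀ t ∈ Icc (-N : ℝ) N,
      LipschitzWith K (v t) ∧ ∀ x, ‖v t x‖ ≤ L) (x₀ : F) :
    ∃ γ : ℝ → F, γ 0 = x₀ ∧ IsIntegralCurve γ v := by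
  choose K L hKL using hv
  have hlocal : ∀ N : ℕ, ∃ α : ℝ → F, α 0 = x₀ ∧
      ∀ t ∈ Ioo (-N : ℝ) N, HasDerivAt α (v t (α t)) t := by
    intro N
    have h0 : (0 : ℝ) ∈ Icc (-N : ℝ) N := by simp
    have hPL : IsPicardLindelof v ⟨0, h0⟩ x₀ (L N * N) 0 (L N) (K N) :=
      { lipschitzOnWith := fun t ht => ((hKL N t ht).1).lipschitzOnWith
        continuousOn := fun x _ => (hcont x).continuousOn
        norm_le := fun t ht x _ => (hKL N t ht).2 x
        mul_max_le := by simp }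
    obtain ⟨α, hα0, hα⟩ := hPL.exists_eq_forall_mem_Icc_hasDerivWithinAt₀
    exact ⟨α, hα0, fun t ht => (hα t (Ioo_subset_Icc_self ht)).hasDerivAt (Icc_mem_nhds ht.1 ht.2)⟩
  choose α hα0 hα using hlocal
  have hagree : ∀ {a b : ℕ}, a ≤ b → EqOn (α a) (α b) (Ioo (-a : ℝ) a) := by
    intro a b hab t ht
    have hab' : (a : ℝ) ≤ b := by exact_mod_cast hab
    have ha : (0 : ℝ) < a := by linarith [ht.1, ht.2]
    have hsub : Ioo (-a : ℝ) a ⊆ Ioo (-b : ℝ) b := Ioo_subset_Ioo (by linarith) hab'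
    refine ODE_solution_unique_of_mem_Ioo (s := fun _ => univ) (t₀ := 0) (K := K a)
      (fun s hs => (hKL a s (Ioo_subset_Icc_self hs)).1.lipschitzOnWith) ⟨by linarith, ha⟩
      (fun s hs => ⟨hα a s hs, mem_univ _⟩) (fun s hs => ⟨hα b s (hsub hs), mem_univ _⟩)
      (by rw [hα0, hα0]) ht
  have hidx : ∀ t : ℝ, |t| < (⌊|t|⌋₊ + 1 : ℕ) := fun t => by
    push_cast
    exact Nat.lt_floor_add_one _
  have hglue : ∀ (N : ℕ) (t : ℝ), |t| < N → α (⌊|t|⌋₊ + 1) t = α N t := by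
    intro N t ht
    rcases le_total (⌊|t|⌋₊ + 1) N with h | h
    · exact hagree h (abs_lt.mp (hidx t))
    · exact (hagree h (abs_lt.mp ht)).symm
  refine ⟨fun t => α (⌊|t|⌋₊ + 1) t, hα0 _, fun t => ?_⟩
  have hev : (fun s => α (⌊|s|⌋₊ + 1) s) =ᶠ[nhds t] α (⌊|t|⌋₊ + 1) := by
    filter_upwards [(continuous_abs.tendsto t).eventually (eventually_lt_nhds (hidx t))] with s hs
    exact hglue _ s hs
  exact (hα _ t (abs_lt.mp (hidx t))).congr_of_eventuallyEq hev

/-- A map into a finite product is locally Lipschitz if its components are. -/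
theorem locallyLipschitz_pi {X ι : Type*} [PseudoEMetricSpace X] [Fintype ι] {f : X → ι → ℝ}
    (hf : ∀ k, LocallyLipschitz fun x => f x k) : LocallyLipschitz f := by
  intro x
  choose K t ht hKt using fun k => hf k x
  refine ⟨∑ k, K k, ⋂ k, t k, Filter.iInter_mem.mpr ht, fun y hy z hz => ?_⟩
  rw [edist_pi_le_iff]
  intro k
  refine (hKt k (Set.mem_iInter.mp hy k) (Set.mem_iInter.mp hz k)).trans ?_
  gcongr
  exact Finset.single_le_sum (f := K) (fun _ _ => zero_le) (Finset.mem_univ k)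

/-- A locally Lipschitz vector field on a proper space is Lipschitz on closed balls. -/
theorem LocallyLipschitz.exists_lipschitzOnWith_closedBall {X Y : Type*} [PseudoMetricSpace X]
    [ProperSpace X] [PseudoMetricSpace Y] {f : X → Y} (hf : LocallyLipschitz f) (x : X) (r : ℝ) :
    ∃ K, LipschitzOnWith K f (Metric.closedBall x r) :=
  (hf.locallyLipschitzOn (s := _)).exists_lipschitzOnWith_of_compact (isCompact_closedBall x r)

/-- Two forward solutions of an autonomous equation with locally Lipschitz right-hand side and the
same initial value coincide. -/
theorem LocallyLipschitz.eq_of_hasDerivAt {F : Type*} [NormedAddCommGroup F] [NormedSpace ℝ F]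
    [ProperSpace F] {v : F → F} (hv : LocallyLipschitz v) {f g : ℝ → F}
    (hf : ∀ t ≥ (0 : ℝ), HasDerivAt f (v (f t)) t) (hg : ∀ t ≥ (0 : ℝ), HasDerivAt g (v (g t)) t)
    (h0 : f 0 = g 0) {T : ℝ} (hT : 0 ≤ T) : f T = g T := by
  have hfc : ContinuousOn f (Set.Icc 0 T) := HasDerivAt.continuousOn fun t ht => hf t ht.1
  have hgc : ContinuousOn g (Set.Icc 0 T) := HasDerivAt.continuousOn fun t ht => hg t ht.1
  obtain ⟨A, hA⟩ := isCompact_Icc.exists_bound_of_continuousOn hfc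
  obtain ⟨B, hB⟩ := isCompact_Icc.exists_bound_of_continuousOn hgc
  obtain ⟨K, hK⟩ := hv.exists_lipschitzOnWith_closedBall 0 (max A B)
  refine ODE_solution_unique_of_mem_Icc_right (v := fun _ => v)
    (s := fun _ => Metric.closedBall 0 (max A B)) (fun _ _ => hK) hfc
    (fun t ht => (hf t ht.1).hasDerivWithinAt)
    (fun t ht => mem_closedBall_zero_iff.mpr
      ((hA t (Set.Ico_subset_Icc_self ht)).trans (le_max_left _ _))) hgc
    (fun t ht => (hg t ht.1).hasDerivWithinAt)
    (fun t ht => mem_closedBall_zero_iff.mpr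
      ((hB t (Set.Ico_subset_Icc_self ht)).trans (le_max_right _ _))) h0 ⟨hT, le_rfl⟩

/-- Coordinatewise truncation to the box `[-r, r]^ι`. -/
def clampBox {ι : Type*} (r : ℝ) (x : ι → ℝ) : ι → ℝ := fun k => max (-r) (min r (x k))

theorem lipschitzWith_clampBox {ι : Type*} [Fintype ι] (r : ℝ) :
    LipschitzWith 1 (clampBox (ι := ι) r) := by
  intro x y
  rw [edist_pi_le_iff]
  intro k
  exact (((LipschitzWith.eval k).const_min r).const_max (-r)) x y

theorem abs_clampBox_le {ι : Type*} {r : ℝ} (hr : 0 ≤ r) (x : ι → ℝ) (k : ι) :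
    |clampBox r x k| ≤ r :=
  abs_le.mpr ⟨le_max_left _ _, max_le (by linarith) (min_le_left _ _)⟩

theorem clampBox_eq_self {ι : Type*} {r : ℝ} {x : ι → ℝ} (h : ∀ k, |x k| ≤ r) :
    clampBox r x = x := by
  funext k
  rw [clampBox, min_eq_right (abs_le.mp (h k)).2, max_eq_right (abs_le.mp (h k)).1]

theorem clampBox_apply_of_eq {ι : Type*} {r : ℝ} (hr : 0 ≤ r) {x : ι → ℝ} {k : ι}
    (h : x k = r) : clampBox r x k = r := by
  rw [clampBox, h, min_self, max_eq_right (by linarith)]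

theorem clampBox_apply_of_eq_neg {ι : Type*} {r : ℝ} (hr : 0 ≤ r) {x : ι → ℝ} {k : ι}
    (h : x k = -r) : clampBox r x k = -r := by
  rw [clampBox, h, min_eq_right (by linarith), max_self]

/-- If a locally Lipschitz vector field, on the faces of a moving box, crosses no face faster than
that face moves outwards, then solutions starting in the box exist for all positive times. -/
theorem LocallyLipschitz.exists_hasDerivAt_of_movingBox {ι : Type*} [Fintype ι]
    {v : (ι → ℝ) → ι → ℝ} (hv : LocallyLipschitz v) {R R' : ℝ → ℝ}
    (hR : ∀ t, HasDerivAt R (R' t) t) (hRnonneg : ∀ t, 0 ≤ R t)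
    (hupper : ∀ t ≥ (0 : ℝ), ∀ x : ι → ℝ, (∀ k, |x k| ≤ R t) → ∀ k, x k = R t → v x k < R' t)
    (hlower : ∀ t ≥ (0 : ℝ), ∀ x : ι → ℝ, (∀ k, |x k| ≤ R t) → ∀ k, x k = -R t → -v x k < R' t)
    {x₀ : ι → ℝ} (hx₀ : ∀ k, |x₀ k| ≤ R 0) :
    ∃ γ : ℝ → ι → ℝ, γ 0 = x₀ ∧ ∀ t ≥ (0 : ℝ), HasDerivAt γ (v (γ t)) t := by
  have hRc : Continuous R := continuous_iff_continuousAt.mpr fun t => (hR t).continuousAt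
  have hcont : ∀ x, Continuous fun t => v (clampBox (R t) x) := by
    intro x
    refine hv.continuous.comp (continuous_pi fun k => ?_)
    exact hRc.neg.max (hRc.min continuous_const)
  have hbdd : ∀ N : ℕ, ∃ K L : NNReal, ∀ t ∈ Set.Icc (-N : ℝ) N,
      LipschitzWith K (fun x => v (clampBox (R t) x)) ∧ ∀ x, ‖v (clampBox (R t) x)‖ ≤ L := by
    intro N
    obtain ⟨B, hB⟩ := (isCompact_Icc (a := (-N : ℝ)) (b := N)).exists_bound_of_continuousOn
      hRc.continuousOn
    obtain ⟨K, hK⟩ := hv.exists_lipschitzOnWith_closedBall 0 B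
    obtain ⟨L, hL⟩ := (isCompact_closedBall (0 : ι → ℝ) B).exists_bound_of_continuousOn
      hv.continuous.continuousOn
    have hmem : ∀ t ∈ Set.Icc (-N : ℝ) N, ∀ x : ι → ℝ,
        clampBox (R t) x ∈ Metric.closedBall (0 : ι → ℝ) B := by
      intro t ht x
      have hRB : R t ≤ B := (le_abs_self _).trans (hB t ht)
      rw [mem_closedBall_zero_iff, pi_norm_le_iff_of_nonneg ((hRnonneg t).trans hRB)]
      exact fun k => (abs_clampBox_le (hRnonneg t) x k).trans hRB
    refine ⟨K, L.toNNReal, fun t ht => ⟨?_, fun x => (hL _ (hmem t ht x)).trans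
      (Real.le_coe_toNNReal L)⟩⟩
    intro x y
    refine (hK (hmem t ht x) (hmem t ht y)).trans ?_
    gcongr
    simpa using lipschitzWith_clampBox (R t) x y
  obtain ⟨γ, hγ0, hγ⟩ := exists_isIntegralCurve_of_lipschitzWith
    (v := fun t x => v (clampBox (R t) x)) hcont hbdd x₀
  refine ⟨γ, hγ0, fun t ht => ?_⟩
  suffices h : ∀ k, |γ t k| ≤ R t by
    simpa only [clampBox_eq_self h] using hγ t
  intro k
  have hγk : ∀ s, HasDerivAt (fun s => γ s k) (v (clampBox (R s) (γ s)) k) s :=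
    fun s => hasDerivAt_pi.mp (hγ s) k
  have hk := abs_le.mp (hx₀ k)
  refine abs_le'.mpr ⟨?_, ?_⟩
  · refine image_le_of_deriv_right_lt_deriv_boundary (f := fun s => γ s k) (a := 0) (b := t)
      (HasDerivAt.continuousOn fun s _ => hγk s) (fun s _ => (hγk s).hasDerivWithinAt)
      (by simpa only [hγ0] using hk.2) hR (fun s hs hsk => ?_) ⟨ht, le_rfl⟩
    exact hupper s hs.1 _ (abs_clampBox_le (hRnonneg s) _) k
      (clampBox_apply_of_eq (hRnonneg s) hsk)
  · refine image_le_of_deriv_right_lt_deriv_boundary (f := fun s => -γ s k) (a := 0) (b := t)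
      (HasDerivAt.continuousOn fun s _ => (hγk s).neg) (fun s _ => (hγk s).neg.hasDerivWithinAt)
      (by simp only [hγ0]; linarith [hk.1]) hR (fun s hs hsk => ?_) ⟨ht, le_rfl⟩
    exact hlower s hs.1 _ (abs_clampBox_le (hRnonneg s) _) k
      (clampBox_apply_of_eq_neg (hRnonneg s) (by linarith))

/-- Existence and uniqueness of a global (on `[0,∞)`) differentiable solution of
the closed-loop swing dynamics, for locally Lipschitz controllers satisfying the
stabilizing sign constraints, from any admissible initial condition in `Φ`. -/
theorem solution_exists_unique
    (n m : ℕ)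
    (D : Matrix (Fin m) (Fin n) ℝ)
    (hD : ∀ k : Fin m, ∃ i j : Fin n, i ≠ j ∧ D k i = 1 ∧ D k j = -1 ∧
      ∀ l, l ≠ i → l ≠ j → D k l = 0)
    (Yb : Fin m → ℝ) (hYb : ∀ j, 0 < Yb j)
    (M E : Fin n → ℝ) (hM : ∀ i, 0 < M i) (hE : ∀ i, 0 < E i)
    (p : Fin n → ℝ) (C : Set (Fin n))
    (u : Fin n → (Fin m → ℝ) → (Fin n → ℝ) → (Fin n → ℝ) → ℝ)
    (hu0 : ∀ i ∉ C, ∀ lam ω q, u i lam ω q = 0)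
    (ωinf : ℝ) (hωinf : ωinf = (∑ i, p i) / (∑ i, E i))
    (lamInf : Fin m → ℝ) (hrange : ∃ θ, D.mulVec θ = lamInf)
    (hbound : ∀ j, |lamInf j| < π / 2)
    (heq : ∀ i, p i - ωinf * E i = ∑ j, D j i * Yb j * Real.sin (lamInf j))
    -- the controllers are locally Lipschitz in the state
    (huLip : ∀ i ∈ C, LocallyLipschitz
      (fun x : (Fin m → ℝ) × (Fin n → ℝ) => u i x.1 x.2 p))
    -- stabilizing sign constraints
    (huSign : ∀ i ∈ C, ∀ (lam : Fin m → ℝ) (ω : Fin n → ℝ),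
      (ω i ≠ ωinf → (ω i - ωinf) * u i lam ω p ≤ 0) ∧
      (ω i = ωinf → u i lam ω p = 0))
    -- the energy function, the closed region, the level constant and `Φ`
    (V : (Fin m → ℝ) → (Fin n → ℝ) → ℝ)
    (hV : V = fun lam ω =>
      (1 / 2) * ∑ i, M i * (ω i - ωinf) ^ 2
        + ∑ j, Yb j * (Real.cos (lamInf j) - Real.cos (lam j)
            - lam j * Real.sin (lamInf j) + lamInf j * Real.sin (lamInf j)))
    (Γcl : Set (Fin m → ℝ)) (hΓcl : Γcl = {lam | ∀ j, |lam j| ≤ π / 2})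
    (c : ℝ) (hc : c = sInf ((fun lam => V lam (fun _ => ωinf)) '' frontier Γcl))
    (β : ℝ) (hβ : 1 < β)
    (Φ : Set ((Fin m → ℝ) × (Fin n → ℝ)))
    (hΦ : Φ = {x | x.1 ∈ Γcl ∧ V x.1 x.2 ≤ c / β})
    -- admissible initial condition
    (lam0 : Fin m → ℝ) (ω0 : Fin n → ℝ)
    (h0range : ∃ θ, D.mulVec θ = lam0) (h0Φ : (lam0, ω0) ∈ Φ) :
    ∃ (lam : ℝ → Fin m → ℝ) (ω : ℝ → Fin n → ℝ),
      (lam 0 = lam0 ∧ ω 0 = ω0 ∧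
        (∀ t ≥ (0 : ℝ), HasDerivAt lam (D.mulVec (ω t)) t) ∧
        (∀ t ≥ (0 : ℝ), ∀ i, HasDerivAt (fun s => ω s i)
          ((-E i * ω t i - (∑ j, D j i * Yb j * Real.sin (lam t j)) + p i
            + u i (lam t) (ω t) p) / M i) t)) ∧
      -- uniqueness: any other solution with the same initial condition agrees on `[0,∞)`
      (∀ (lam' : ℝ → Fin m → ℝ) (ω' : ℝ → Fin n → ℝ),
        lam' 0 = lam0 → ω' 0 = ω0 →
        (∀ t ≥ (0 : ℝ), HasDerivAt lam' (D.mulVec (ω' t)) t) →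
        (∀ t ≥ (0 : ℝ), ∀ i, HasDerivAt (fun s => ω' s i)
          ((-E i * ω' t i - (∑ j, D j i * Yb j * Real.sin (lam' t j)) + p i
            + u i (lam' t) (ω' t) p) / M i) t) →
        ∀ t ≥ (0 : ℝ), lam' t = lam t ∧ ω' t = ω t) := by
  have huLip' : ∀ i, LocallyLipschitz
      (fun x : (Fin m → ℝ) × (Fin n → ℝ) => u i x.1 x.2 p) := by
    intro i
    by_cases hi : i ∈ C
    · exact huLip i hi
    · simpa only [hu0 i hi] using LocallyLipschitz.const (0 : ℝ)
  have huSign' : ∀ i (lam : Fin m → ℝ) (ω : Fin n → ℝ), (ω i - ωinf) * u i lam ω p ≤ 0 := by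
    intro i lam ω
    by_cases hi : i ∈ C
    · by_cases h : ω i = ωinf
      · simp [h]
      · exact (huSign i hi lam ω).1 h
    · simp [hu0 i hi]
  set κ : ℝ := 1 + ∑ j, ∑ i, |D j i| + ∑ i, (∑ j, |D j i * Yb j| + |p i|) / M i with hκ
  set W : ℝ := 1 + |ωinf| + ∑ j, |lam0 j| + ∑ i, |ω0 i| with hW
  let v : (Fin m ⊕ Fin n → ℝ) → Fin m ⊕ Fin n → ℝ := fun z => Sum.elim
    (D.mulVec fun i => z (Sum.inr i))
    (fun i => (-E i * z (Sum.inr i)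
      - (∑ j, D j i * Yb j * Real.sin (z (Sum.inl j))) + p i
      + u i (fun j => z (Sum.inl j)) (fun l => z (Sum.inr l)) p) / M i)
  have hnn₁ : ∀ j, 0 ≤ ∑ i, |D j i| := fun j => Finset.sum_nonneg fun i _ => abs_nonneg _
  have hnn₂ : ∀ i, 0 ≤ (∑ j, |D j i * Yb j| + |p i|) / M i := fun i =>
    div_nonneg (add_nonneg (Finset.sum_nonneg fun j _ => abs_nonneg _) (abs_nonneg _)) (hM i).le
  have hnn₁' := Finset.sum_nonneg fun j (_ : j ∈ Finset.univ) => hnn₁ j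
  have hnn₂' := Finset.sum_nonneg fun i (_ : i ∈ Finset.univ) => hnn₂ i
  have hκ₁ : ∀ j, ∑ i, |D j i| < κ := fun j => by
    have := Finset.single_le_sum (fun j _ => hnn₁ j) (Finset.mem_univ j)
    linarith
  have hκ₂ : ∀ i, (∑ j, |D j i * Yb j| + |p i|) / M i < κ := fun i => by
    have := Finset.single_le_sum (fun i _ => hnn₂ i) (Finset.mem_univ i)
    linarith
  have hκ0 : 0 < κ := by linarith
  have hWl : 0 ≤ ∑ j, |lam0 j| := Finset.sum_nonneg fun j _ => abs_nonneg _
  have hWr : 0 ≤ ∑ i, |ω0 i| := Finset.sum_nonneg fun i _ => abs_nonneg _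
  have hW1 : 1 ≤ W := by linarith [abs_nonneg ωinf]
  have hWω : |ωinf| < W := by linarith
  have hWexp : ∀ t ≥ (0 : ℝ), W ≤ W * Real.exp (κ * t) := fun t ht =>
    le_mul_of_one_le_right (by linarith) (Real.one_le_exp (by positivity))
  have hv : LocallyLipschitz v := by
    refine locallyLipschitz_pi ?_
    rintro (j | i)
    · refine ContDiff.locallyLipschitz (𝕂 := ℝ) ?_
      simp only [v, Sum.elim_inl, Matrix.mulVec, dotProduct]
      fun_prop
    · simp only [v, Sum.elim_inr, add_div]
      refine LocallyLipschitz.add (ContDiff.locallyLipschitz (𝕂 := ℝ) (by fun_prop)) ?_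
      have hproj : LocallyLipschitz fun z : Fin m ⊕ Fin n → ℝ =>
          ((fun j => z (Sum.inl j), fun l => z (Sum.inr l)) : (Fin m → ℝ) × (Fin n → ℝ)) :=
        ContDiff.locallyLipschitz (𝕂 := ℝ) (by fun_prop)
      exact (ContDiff.locallyLipschitz (𝕂 := ℝ) (f := fun r : ℝ => r / M i) (by fun_prop)).comp
        ((huLip' i).comp hproj)
  have hvinl : ∀ (r : ℝ) (x : Fin m ⊕ Fin n → ℝ), (∀ k, |x k| ≤ r) → 0 < r → ∀ j,
      |v x (Sum.inl j)| < κ * r := by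
    intro r x hx hr j
    calc |v x (Sum.inl j)| = |∑ i, D j i * x (Sum.inr i)| := rfl
      _ ≤ ∑ i, |D j i * x (Sum.inr i)| := Finset.abs_sum_le_sum_abs _ _
      _ ≤ ∑ i, |D j i| * r := Finset.sum_le_sum fun i _ => by
          rw [abs_mul]
          exact mul_le_mul_of_nonneg_left (hx _) (abs_nonneg _)
      _ = (∑ i, |D j i|) * r := (Finset.sum_mul ..).symm
      _ < κ * r := mul_lt_mul_of_pos_right (hκ₁ j) hr
  have hforce : ∀ (x : Fin m ⊕ Fin n → ℝ) i,
      |(∑ j, D j i * Yb j * Real.sin (x (Sum.inl j))) - p i| < κ * M i := by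
    intro x i
    refine lt_of_le_of_lt ?_ ((div_lt_iff₀ (hM i)).mp (hκ₂ i))
    refine (abs_sub _ _).trans (add_le_add_left ?_ _)
    refine (Finset.abs_sum_le_sum_abs _ _).trans (Finset.sum_le_sum fun j _ => ?_)
    rw [abs_mul]
    exact mul_le_of_le_one_right (abs_nonneg _) (Real.abs_sin_le_one _)
  have hinit : ∀ k, |Sum.elim lam0 ω0 k| ≤ W * Real.exp (κ * 0) := by
    simp only [mul_zero, Real.exp_zero, mul_one]
    rintro (j | i)
    · have := Finset.single_le_sum (fun j _ => abs_nonneg (lam0 j)) (Finset.mem_univ j)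
      simp only [Sum.elim_inl]
      linarith [abs_nonneg ωinf]
    · have := Finset.single_le_sum (fun i _ => abs_nonneg (ω0 i)) (Finset.mem_univ i)
      simp only [Sum.elim_inr]
      linarith [abs_nonneg ωinf]
  obtain ⟨γ, hγ0, hγ⟩ := hv.exists_hasDerivAt_of_movingBox
    (R := fun t => W * Real.exp (κ * t)) (R' := fun t => κ * (W * Real.exp (κ * t)))
    (fun t => by
      have := (((hasDerivAt_id t).const_mul κ).exp).const_mul W
      convert! this using 1
      simp; ring)
    (fun t => by positivity)
    (fun t ht x hx k hk => by
      have hr := hWexp t ht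
      set r := W * Real.exp (κ * t)
      rcases k with j | i
      · exact (abs_lt.mp (hvinl r x hx (by linarith) j)).2
      · have hu := huSign' i (fun j => x (Sum.inl j)) (fun l => x (Sum.inr l))
        have hpos : 0 < x (Sum.inr i) - ωinf := by linarith [le_abs_self ωinf]
        have hu' := nonpos_of_mul_nonpos_right hu hpos
        have hE' : 0 ≤ E i * x (Sum.inr i) := mul_nonneg (hE i).le (by linarith)
        have hf := abs_lt.mp (hforce x i)
        refine lt_of_lt_of_le ?_ (le_mul_of_one_le_right hκ0.le (hW1.trans hr))
        simp only [v, Sum.elim_inr]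
        rw [div_lt_iff₀ (hM i)]
        linarith)
    (fun t ht x hx k hk => by
      have hr := hWexp t ht
      set r := W * Real.exp (κ * t)
      rcases k with j | i
      · exact neg_lt.mp (abs_lt.mp (hvinl r x hx (by linarith) j)).1
      · have hu := huSign' i (fun j => x (Sum.inl j)) (fun l => x (Sum.inr l))
        have hneg : x (Sum.inr i) - ωinf < 0 := by linarith [neg_abs_le ωinf]
        have hu' := nonneg_of_mul_nonpos_right hu hneg
        have hE' : E i * x (Sum.inr i) ≤ 0 :=
          mul_nonpos_of_nonneg_of_nonpos (hE i).le (by linarith)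
        have hf := abs_lt.mp (hforce x i)
        refine lt_of_lt_of_le ?_ (le_mul_of_one_le_right hκ0.le (hW1.trans hr))
        simp only [v, Sum.elim_inr]
        rw [← neg_div, div_lt_iff₀ (hM i)]
        linarith)
    (x₀ := Sum.elim lam0 ω0) hinit
  refine ⟨fun t j => γ t (Sum.inl j), fun t i => γ t (Sum.inr i),
    ⟨by simp [hγ0], by simp [hγ0], fun t ht => ?_, fun t ht i => ?_⟩, ?_⟩
  · exact hasDerivAt_pi.mpr fun j => hasDerivAt_pi.mp (hγ t ht) (Sum.inl j)
  · exact hasDerivAt_pi.mp (hγ t ht) (Sum.inr i)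
  · intro lam' ω' hl hw hdl hdw t ht
    have key := hv.eq_of_hasDerivAt (f := fun s => Sum.elim (lam' s) (ω' s)) (g := γ)
      (fun s hs => hasDerivAt_pi.mpr (by
        rintro (j | i)
        · exact hasDerivAt_pi.mp (hdl s hs) j
        · exact hdw s hs i)) hγ (by simp [hγ0, hl, hw]) ht
    exact ⟨funext fun j => congrFun key (Sum.inl j), funext fun i => congrFun key (Sum.inr i)⟩
end

section
/- Fix i ∈ 𝔠, bounds ω̲_i < ω̲_i^th < ω̄_i^th < ω̄_i, and Lipschitz class-K functions ᾱ_i, α̲_i : ℝ → ℝ (Lipschitz, continuous, strictly increasing, vanishing at 0). Then the function (λ,ω) ↦ u_i(λ,ω,p) defined by u_i(λ,ω,p) = min{0, −ᾱ_i(ω_i − ω̄_i)/(ω_i − ω̄_i^th) + q_i(λ,ω,p)} if ω_i > ω̄_i^th; u_i(λ,ω,p) = 0 if ω̲_i^th ≤ ω_i ≤ ω̄_i^th; and u_i(λ,ω,p) = max{0, α̲_i(ω̲_i − ω_i)/(ω̲_i^th − ω_i) + q_i(λ,ω,p)} if ω_i < ω̲_i^th, is locally Lipschitz on ℝ^m ×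 ℝ^n (for each fixed p ∈ ℝ^n). -/
open Real BigOperators

open Topology

/-- Being Lipschitz on a set depends only on the values on that set. -/
lemma LipschitzOnWith.of_eqOn {X Y : Type*} [PseudoEMetricSpace X] [PseudoEMetricSpace Y]
    {K : NNReal} {f g : X → Y} {s : Set X} (hf : LipschitzOnWith K f s) (hfg : Set.EqOn g f s) :
    LipschitzOnWith K g s := fun x hx y hy => by
  rw [hfg hx, hfg hy]
  exact hf hx hy

/-- Composing a locally Lipschitz map with a function that is `C¹` at a single value of it gives a
function that is Lipschitz near the corresponding point. -/
lemma ContDiffAt.exists_lipschitzOnWith_comp {X E F : Type*} [PseudoEMetricSpace X]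
    [NormedAddCommGroup E] [NormedSpace ℝ E] [NormedAddCommGroup F] [NormedSpace ℝ F]
    {G : E → F} {h : X → E} {x : X} (hG : ContDiffAt ℝ 1 G (h x)) (hh : LocallyLipschitz h) :
    ∃ K, ∃ t ∈ 𝓝 x, LipschitzOnWith K (fun y => G (h y)) t := by
  obtain ⟨K, s, hs, hK⟩ := hG.exists_lipschitzOnWith
  obtain ⟨L, t, ht, hL⟩ := hh x
  exact ⟨K * L, t ∩ h ⁻¹' s, Filter.inter_mem ht (hh.continuous.continuousAt hs),
    hK.comp (hL.mono Set.inter_subset_left) fun y hy => hy.2⟩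

/-- A barrier term `-v / w + q`, cut off at `0` from above and switched on only where `w > 0`, is
locally Lipschitz as soon as `v < 0` wherever `w ≤ 0`. -/
lemma LocallyLipschitz.ite_min_zero_neg_div_add {X : Type*} [PseudoEMetricSpace X]
    {v w q : X → ℝ} (hv : LocallyLipschitz v) (hw : LocallyLipschitz w)
    (hq : LocallyLipschitz q) (hneg : ∀ x, w x ≤ 0 → v x < 0) :
    LocallyLipschitz (fun x => if 0 < w x then min 0 (-(v x) / w x + q x) else 0) := by
  intro x
  rcases lt_or_ge 0 (w x) with hx | hx
  · have hG : ContDiffAt ℝ 1 (fun z : ℝ × ℝ × ℝ => -z.1 / z.2.1 + z.2.2) (v x, w x, q x) := by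
      have hx' : ((v x, w x, q x) : ℝ × ℝ × ℝ).2.1 ≠ 0 := hx.ne'
      fun_prop (disch := assumption)
    obtain ⟨K, t, ht, hK⟩ := hG.exists_lipschitzOnWith_comp (h := fun y => (v y, w y, q y))
      (hv.prodMk (hw.prodMk hq))
    refine ⟨K, t ∩ {y | 0 < w y},
      Filter.inter_mem ht (hw.continuous.continuousAt.eventually_const_lt hx), ?_⟩
    have hmin := ((LipschitzWith.id (α := ℝ)).const_min 0).comp_lipschitzOnWith
      (hK.mono (Set.inter_subset_left (t := {y | 0 < w y})))
    rw [one_mul] at hmin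
    exact LipschitzOnWith.of_eqOn hmin fun y hy => by simp [show 0 < w y from hy.2]
  · have hcont : ContinuousAt (fun y => -(v y) + q y * max 0 (w y)) x :=
      (hv.continuous.neg.add
        (hq.continuous.mul (continuous_const.max hw.continuous))).continuousAt
    have hpos : 0 < -(v x) + q x * max 0 (w x) := by
      simpa [max_eq_left hx] using hneg x hx
    refine ⟨0, _, hcont.eventually_const_lt hpos, ?_⟩
    refine LipschitzOnWith.of_eqOn (LipschitzWith.const (0 : ℝ)).lipschitzOnWith fun y hy => ?_
    have hy' : 0 < -(v y) + q y * max 0 (w y) := hy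
    split_ifs with hwy
    · rw [max_eq_right hwy.le] at hy'
      have hsum : -(v y) / w y + q y = (-(v y) + q y * w y) / w y := by field_simp
      rw [hsum, min_eq_left (div_pos hy' hwy).le]
    · rfl

/-- The distributed transient frequency controller
`u_i(λ,ω,p) = min{0, −ᾱ_i(ω_i−ω̄_i)/(ω_i−ω̄_i^th) + q_i}` for `ω_i > ω̄_i^th`,
`0` for `ω̲_i^th ≤ ω_i ≤ ω̄_i^th`, and
`max{0, α̲_i(ω̲_i−ω_i)/(ω̲_i^th−ω_i) + q_i}` for `ω_i < ω̲_i^th`,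
built from Lipschitz class-K functions, is locally Lipschitz in the state. -/
theorem controller_locally_lipschitz
    (n m : ℕ)
    (D : Matrix (Fin m) (Fin n) ℝ)
    (Yb : Fin m → ℝ) (hYb : ∀ j, 0 < Yb j)
    (E : Fin n → ℝ) (hE : ∀ i, 0 < E i)
    (p : Fin n → ℝ) (C : Set (Fin n)) (i : Fin n) (hiC : i ∈ C)
    (wl wlth wuth wu : ℝ) (h1 : wl < wlth) (h2 : wlth < wuth) (h3 : wuth < wu)
    -- Lipschitz class-K functions
    (ab al : ℝ → ℝ)
    (habC : Continuous ab) (habM : StrictMono ab) (hab0 : ab 0 = 0)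
    (habL : ∃ K : NNReal, LipschitzWith K ab)
    (halC : Continuous al) (halM : StrictMono al) (hal0 : al 0 = 0)
    (halL : ∃ K : NNReal, LipschitzWith K al) :
    LocallyLipschitz (fun x : (Fin m → ℝ) × (Fin n → ℝ) =>
      if wuth < x.2 i then
        min 0 (-(ab (x.2 i - wu)) / (x.2 i - wuth)
          + (E i * x.2 i + (∑ j, D j i * Yb j * Real.sin (x.1 j)) - p i))
      else if x.2 i < wlth then
        max 0 (al (wl - x.2 i) / (wlth - x.2 i)
          + (E i * x.2 i + (∑ j, D j i * Yb j * Real.sin (x.1 j)) - p i))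
      else 0) := by
  obtain ⟨K, hK⟩ := habL
  obtain ⟨L, hL⟩ := halL
  set q : (Fin m → ℝ) × (Fin n → ℝ) → ℝ := fun x =>
    E i * x.2 i + (∑ j, D j i * Yb j * Real.sin (x.1 j)) - p i with hq_def
  have hq : LocallyLipschitz q :=
    ContDiff.locallyLipschitz (𝕂 := ℝ) (by unfold q; fun_prop)
  have hupper : LocallyLipschitz fun x : (Fin m → ℝ) × (Fin n → ℝ) =>
      if 0 < x.2 i - wuth then min 0 (-(ab (x.2 i - wu)) / (x.2 i - wuth) + q x) else 0 := by
    refine LocallyLipschitz.ite_min_zero_neg_div_add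
      (hK.locallyLipschitz.comp (g := fun x : (Fin m → ℝ) × (Fin n → ℝ) => x.2 i - wu)
        (ContDiff.locallyLipschitz (𝕂 := ℝ) (by fun_prop)))
      (ContDiff.locallyLipschitz (𝕂 := ℝ) (by fun_prop)) hq fun x hx => ?_
    exact hab0 ▸ habM (by linarith : x.2 i - wu < 0)
  have hlower : LocallyLipschitz fun x : (Fin m → ℝ) × (Fin n → ℝ) =>
      if 0 < wlth - x.2 i then min 0 (-(al (wl - x.2 i)) / (wlth - x.2 i) + -q x) else 0 := by
    refine LocallyLipschitz.ite_min_zero_neg_div_add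
      (hL.locallyLipschitz.comp (g := fun x : (Fin m → ℝ) × (Fin n → ℝ) => wl - x.2 i)
        (ContDiff.locallyLipschitz (𝕂 := ℝ) (by fun_prop)))
      (ContDiff.locallyLipschitz (𝕂 := ℝ) (by fun_prop)) hq.neg fun x hx => ?_
    exact hal0 ▸ halM (by linarith : wl - x.2 i < 0)
  convert! hupper.sub hlower using 1
  funext x
  simp only [sub_pos]
  split_ifs with hu hl hl
  · linarith
  · simp [hq_def]
  · rw [zero_sub, neg_div, ← neg_add, ← neg_zero, min_neg_neg, neg_neg, neg_zero]
  · simp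
end

section
/- Fix i ∈ 𝔠 and let u_i be the distributed transient frequency controller with thresholds ω̲_i < ω̲_i^th < ω̄_i^th < ω̄_i and Lipschitz class-K functions ᾱ_i, α̲_i. Then along any differentiable solution (λ(·),ω(·)) on [0,∞) of the closed-loop swing dynamics: if ω_i(0) ∈ [ω̲_i, ω̄_i], then ω_i(t) ∈ [ω̲_i, ω̄_i] for all t ≥ 0. -/
open Real BigOperators

/-- `q_i(λ,ω,p) = E_i ω_i + [DᵀY_b]_i sin λ − p_i`. -/
noncomputable def qi {n m : ℕ} (D : Matrix (Fin m) (Fin n) ℝ) (Yb : Fin m → ℝ)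
    (E p : Fin n → ℝ) (i : Fin n) (lam : Fin m → ℝ) (ω : Fin n → ℝ) : ℝ :=
  E i * ω i + (∑ j, D j i * Yb j * Real.sin (lam j)) - p i

/-- The distributed transient frequency controller, as a function of
`q = q_i(λ,ω,p)` and `wi = ω_i`. -/
noncomputable def ctrl (ab al : ℝ → ℝ) (wl wlth wuth wu : ℝ) (q wi : ℝ) : ℝ :=
  if wuth < wi then min 0 (-(ab (wi - wu)) / (wi - wuth) + q)
  else if wi < wlth then max 0 (al (wl - wi) / (wlth - wi) + q)
  else 0

/-- A function starting at or below the level `c`, whose derivative is negative wherever the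
function exceeds `c`, stays at or below `c`. -/
theorem le_of_hasDerivAt_neg_above {f f' : ℝ → ℝ} {c : ℝ}
    (hf : ∀ t ≥ (0 : ℝ), HasDerivAt f (f' t) t) (h0 : f 0 ≤ c)
    (hneg : ∀ t ≥ (0 : ℝ), c < f t → f' t < 0) {t : ℝ} (ht : 0 ≤ t) : f t ≤ c := by
  refine le_of_forall_pos_le_add fun ε hε => ?_
  refine image_le_of_deriv_right_lt_deriv_boundary (a := 0) (b := t) (f := f) (f' := f')
    (B := fun _ => c + ε) (B' := fun _ => 0)
    (fun x hx => (hf x hx.1).continuousAt.continuousWithinAt)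
    (fun x hx => (hf x hx.1).hasDerivWithinAt) (by linarith)
    (fun x => hasDerivAt_const x (c + ε)) (fun x hx hfx => ?_) ⟨ht, le_rfl⟩
  exact hneg x hx.1 (by linarith)

theorem ctrl_lt_of_above {ab al : ℝ → ℝ} {wl wlth wuth wu : ℝ} (h : wuth < wu)
    (hab : StrictMono ab) (hab0 : ab 0 = 0) (q : ℝ) {x : ℝ} (hx : wu < x) :
    ctrl ab al wl wlth wuth wu q x < q := by
  have hpos : 0 < ab (x - wu) := hab0 ▸ hab (sub_pos.2 hx)
  have hdiv : -(ab (x - wu)) / (x - wuth) < 0 :=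
    div_neg_of_neg_of_pos (neg_neg_of_pos hpos) (by linarith)
  rw [ctrl, if_pos (h.trans hx)]
  exact (min_le_right _ _).trans_lt (by linarith)

theorem lt_ctrl_of_below {ab al : ℝ → ℝ} {wl wlth wuth wu : ℝ} (h : wl < wlth)
    (h' : wlth < wuth) (hal : StrictMono al) (hal0 : al 0 = 0) (q : ℝ) {x : ℝ} (hx : x < wl) :
    q < ctrl ab al wl wlth wuth wu q x := by
  have hpos : 0 < al (wl - x) := hal0 ▸ hal (sub_pos.2 hx)
  have hdiv : 0 < al (wl - x) / (wlth - x) := div_pos hpos (by linarith)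
  rw [ctrl, if_neg (by linarith), if_pos (hx.trans h)]
  exact lt_of_lt_of_le (by linarith) (le_max_right _ _)

/-- Frequency invariance under the distributed transient frequency controller:
if `ω_i(0) ∈ [ω̲_i, ω̄_i]`, then `ω_i(t) ∈ [ω̲_i, ω̄_i]` for all `t ≥ 0`. -/
theorem controller_frequency_invariance
    (n m : ℕ)
    (D : Matrix (Fin m) (Fin n) ℝ)
    (Yb : Fin m → ℝ) (hYb : ∀ j, 0 < Yb j)
    (M E : Fin n → ℝ) (hM : ∀ i, 0 < M i) (hE : ∀ i, 0 < E i)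
    (p : Fin n → ℝ) (C : Set (Fin n))
    (u : Fin n → (Fin m → ℝ) → (Fin n → ℝ) → (Fin n → ℝ) → ℝ)
    (hu0 : ∀ i ∉ C, ∀ lam ω q, u i lam ω q = 0)
    (i : Fin n) (hiC : i ∈ C)
    (wl wlth wuth wu : ℝ) (h1 : wl < wlth) (h2 : wlth < wuth) (h3 : wuth < wu)
    -- Lipschitz class-K functions
    (ab al : ℝ → ℝ)
    (habC : Continuous ab) (habM : StrictMono ab) (hab0 : ab 0 = 0)
    (habL : ∃ K : NNReal, LipschitzWith K ab)
    (halC : Continuous al) (halM : StrictMono al) (hal0 : al 0 = 0)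
    (halL : ∃ K : NNReal, LipschitzWith K al)
    -- bus `i` uses the distributed transient frequency controller
    (hui : ∀ (lam : Fin m → ℝ) (ω : Fin n → ℝ),
      u i lam ω p = ctrl ab al wl wlth wuth wu (qi D Yb E p i lam ω) (ω i))
    -- a differentiable solution of the closed-loop dynamics
    (lam : ℝ → Fin m → ℝ) (ω : ℝ → Fin n → ℝ) (ωd : ℝ → Fin n → ℝ)
    (hlam : ∀ t ≥ (0 : ℝ), HasDerivAt lam (D.mulVec (ω t)) t)
    (hω : ∀ t ≥ (0 : ℝ), ∀ k, HasDerivAt (fun s => ω s k) (ωd t k) t)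
    (hdyn : ∀ t ≥ (0 : ℝ), ∀ k, M k * ωd t k =
      -E k * ω t k - (∑ j, D j k * Yb j * Real.sin (lam t j)) + p k
        + u k (lam t) (ω t) p) :
    ω 0 i ∈ Set.Icc wl wu → ∀ t ≥ (0 : ℝ), ω t i ∈ Set.Icc wl wu := by
  rintro ⟨hl, hr⟩ t ht
  have hq : ∀ s ≥ (0 : ℝ), M i * ωd s i =
      ctrl ab al wl wlth wuth wu (qi D Yb E p i (lam s) (ω s)) (ω s i)
        - qi D Yb E p i (lam s) (ω s) := fun s hs => by
    rw [hdyn s hs i, hui]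
    simp only [qi]
    ring
  constructor
  · refine neg_le_neg_iff.1 (le_of_hasDerivAt_neg_above (f := fun s => -ω s i)
      (fun s hs => (hω s hs i).neg) (neg_le_neg hl) (fun s hs hlt => ?_) ht)
    have := lt_ctrl_of_below (ab := ab) (wu := wu) h1 h2 halM hal0
      (qi D Yb E p i (lam s) (ω s)) (neg_lt_neg_iff.1 hlt)
    exact neg_neg_of_pos (pos_of_mul_pos_right (by rw [hq s hs]; linarith) (hM i).le)
  · refine le_of_hasDerivAt_neg_above (f := fun s => ω s i) (fun s hs => hω s hs i) hr
      (fun s hs hlt => ?_) ht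
    have := ctrl_lt_of_above (al := al) (wl := wl) (wlth := wlth) h3 habM hab0
      (qi D Yb E p i (lam s) (ω s)) hlt
    exact neg_of_mul_neg_right (by rw [hq s hs]; linarith) (hM i).le
end

section
/- Fix i ∈ 𝔠 and let u_i be the distributed transient frequency controller with thresholds ω̲_i < ω̲_i^th < ω̄_i^th < ω̄_i and Lipschitz class-K functions ᾱ_i, α̲_i. Then along any differentiable solution (λ(·),ω(·)) on [0,∞) of the closed-loop swing dynamics, at every time t: if ω_i(t) > ω̄_i then M_i ω̇_i(t) ≤ −ᾱ_i(ω_i(t) − ω̄_i)/(ω_i(t) − ω̄_i^th) ≤ 0, and if ω_i(t) < ω̲_i then M_i ω̇_i(t) ≥ α̲_i(ω̲_i − ω_i(t))/(ω̲_i^th − ω_i(t)) ≥ 0; in particular, outside the safe interval [ω̲_i, ω̄_i] the frequency ω_i(t) monotonically approaches the interval. -/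
open Real BigOperators

theorem ctrl_le_of_lt {ab al : ℝ → ℝ} {wl wlth wuth wu q wi : ℝ} (h : wuth < wi) :
    ctrl ab al wl wlth wuth wu q wi ≤ -(ab (wi - wu)) / (wi - wuth) + q := by
  rw [ctrl, if_pos h]
  exact min_le_right _ _

theorem le_ctrl_of_lt {ab al : ℝ → ℝ} {wl wlth wuth wu q wi : ℝ} (hth : wlth ≤ wuth)
    (h : wi < wlth) :
    al (wl - wi) / (wlth - wi) + q ≤ ctrl ab al wl wlth wuth wu q wi := by
  rw [ctrl, if_neg (h.trans_le hth).not_gt, if_pos h]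
  exact le_max_right _ _

theorem le_of_hasDerivAt_nonpos {f f' : ℝ → ℝ} {s t : ℝ} (hst : s ≤ t)
    (hf : ∀ r ∈ Set.Icc s t, HasDerivAt f (f' r) r) (hf' : ∀ r ∈ Set.Icc s t, f' r ≤ 0) :
    f t ≤ f s := by
  refine antitoneOn_of_deriv_nonpos (convex_Icc s t)
    (fun r hr => (hf r hr).continuousAt.continuousWithinAt)
    (fun r hr => (hf r (interior_subset hr)).differentiableAt.differentiableWithinAt)
    (fun r hr => ?_) (Set.left_mem_Icc.2 hst) (Set.right_mem_Icc.2 hst) hst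
  rw [(hf r (interior_subset hr)).deriv]
  exact hf' r (interior_subset hr)

/-- Outside the safe interval, the distributed transient frequency controller
forces the frequency derivative to point back towards the safe interval:
if `ω_i(t) > ω̄_i` then `M_i ω̇_i(t) ≤ −ᾱ_i(ω_i(t)−ω̄_i)/(ω_i(t)−ω̄_i^th) ≤ 0`,
and if `ω_i(t) < ω̲_i` then `M_i ω̇_i(t) ≥ α̲_i(ω̲_i−ω_i(t))/(ω̲_i^th−ω_i(t)) ≥ 0`;
in particular the frequency monotonically approaches the safe interval. -/
theorem controller_monotone_attractivity
    (n m : ℕ)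
    (D : Matrix (Fin m) (Fin n) ℝ)
    (Yb : Fin m → ℝ) (hYb : ∀ j, 0 < Yb j)
    (M E : Fin n → ℝ) (hM : ∀ i, 0 < M i) (hE : ∀ i, 0 < E i)
    (p : Fin n → ℝ) (C : Set (Fin n))
    (u : Fin n → (Fin m → ℝ) → (Fin n → ℝ) → (Fin n → ℝ) → ℝ)
    (hu0 : ∀ i ∉ C, ∀ lam ω q, u i lam ω q = 0)
    (i : Fin n) (hiC : i ∈ C)
    (wl wlth wuth wu : ℝ) (h1 : wl < wlth) (h2 : wlth < wuth) (h3 : wuth < wu)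
    -- Lipschitz class-K functions
    (ab al : ℝ → ℝ)
    (habC : Continuous ab) (habM : StrictMono ab) (hab0 : ab 0 = 0)
    (habL : ∃ K : NNReal, LipschitzWith K ab)
    (halC : Continuous al) (halM : StrictMono al) (hal0 : al 0 = 0)
    (halL : ∃ K : NNReal, LipschitzWith K al)
    -- bus `i` uses the distributed transient frequency controller
    (hui : ∀ (lam : Fin m → ℝ) (ω : Fin n → ℝ),
      u i lam ω p = ctrl ab al wl wlth wuth wu (qi D Yb E p i lam ω) (ω i))
    -- a differentiable solution of the closed-loop dynamics
    (lam : ℝ → Fin m → ℝ) (ω : ℝ → Fin n → ℝ) (ωd : ℝ → Fin n → ℝ)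
    (hlam : ∀ t ≥ (0 : ℝ), HasDerivAt lam (D.mulVec (ω t)) t)
    (hω : ∀ t ≥ (0 : ℝ), ∀ k, HasDerivAt (fun s => ω s k) (ωd t k) t)
    (hdyn : ∀ t ≥ (0 : ℝ), ∀ k, M k * ωd t k =
      -E k * ω t k - (∑ j, D j k * Yb j * Real.sin (lam t j)) + p k
        + u k (lam t) (ω t) p) :
    (∀ t ≥ (0 : ℝ), wu < ω t i →
      M i * ωd t i ≤ -(ab (ω t i - wu)) / (ω t i - wuth) ∧
      -(ab (ω t i - wu)) / (ω t i - wuth) ≤ 0) ∧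
    (∀ t ≥ (0 : ℝ), ω t i < wl →
      al (wl - ω t i) / (wlth - ω t i) ≤ M i * ωd t i ∧
      0 ≤ al (wl - ω t i) / (wlth - ω t i)) ∧
    -- monotone approach to the safe interval
    (∀ s t : ℝ, 0 ≤ s → s ≤ t → (∀ r ∈ Set.Icc s t, wu < ω r i) →
      ω t i ≤ ω s i) ∧
    (∀ s t : ℝ, 0 ≤ s → s ≤ t → (∀ r ∈ Set.Icc s t, ω r i < wl) →
      ω s i ≤ ω t i) := by
  have hclosed : ∀ t ≥ (0 : ℝ), M i * ωd t i = -qi D Yb E p i (lam t) (ω t) +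
      ctrl ab al wl wlth wuth wu (qi D Yb E p i (lam t) (ω t)) (ω t i) := by
    intro t ht
    rw [hdyn t ht i, hui, qi]
    ring
  have upper : ∀ t ≥ (0 : ℝ), wu < ω t i →
      M i * ωd t i ≤ -(ab (ω t i - wu)) / (ω t i - wuth) ∧
      -(ab (ω t i - wu)) / (ω t i - wuth) ≤ 0 := by
    intro t ht hw
    have hab : 0 < ab (ω t i - wu) := hab0 ▸ habM (sub_pos.2 hw)
    refine ⟨?_, div_nonpos_of_nonpos_of_nonneg (by linarith) (by linarith)⟩
    have := ctrl_le_of_lt (ab := ab) (al := al) (wl := wl) (wlth := wlth) (wu := wu)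
      (q := qi D Yb E p i (lam t) (ω t)) (h3.trans hw)
    linarith [hclosed t ht]
  have lower : ∀ t ≥ (0 : ℝ), ω t i < wl →
      al (wl - ω t i) / (wlth - ω t i) ≤ M i * ωd t i ∧
      0 ≤ al (wl - ω t i) / (wlth - ω t i) := by
    intro t ht hw
    have hal : 0 < al (wl - ω t i) := hal0 ▸ halM (sub_pos.2 hw)
    refine ⟨?_, div_nonneg hal.le (by linarith)⟩
    have := le_ctrl_of_lt (ab := ab) (al := al) (wl := wl) (wu := wu)
      (q := qi D Yb E p i (lam t) (ω t)) h2.le (hw.trans h1)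
    linarith [hclosed t ht]
  refine ⟨upper, lower, fun s t hs hst h => ?_, fun s t hs hst h => ?_⟩
  · refine le_of_hasDerivAt_nonpos (f := fun r => ω r i) (f' := fun r => ωd r i) hst
      (fun r hr => hω r (hs.trans hr.1) i) (fun r hr => ?_)
    obtain ⟨hle, hle0⟩ := upper r (hs.trans hr.1) (h r hr)
    exact nonpos_of_mul_nonpos_right (hle.trans hle0) (hM i)
  · refine neg_le_neg_iff.1 (le_of_hasDerivAt_nonpos (f := fun r => -ω r i)
      (f' := fun r => -ωd r i) hst (fun r hr => (hω r (hs.trans hr.1) i).neg) (fun r hr => ?_))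
    obtain ⟨hle, hle0⟩ := lower r (hs.trans hr.1) (h r hr)
    exact neg_nonpos.2 (nonneg_of_mul_nonneg_right (hle0.trans hle) (hM i))
end

section
/- For each i ∈ 𝔠 let u_i be the distributed transient frequency controller with thresholds ω̲_i < ω̲_i^th < ω̄_i^th < ω̄_i and Lipschitz class-K functions ᾱ_i, α̲_i, and suppose ω^∞ ∈ (ω̲_i^th, ω̄_i^th) for all i ∈ 𝔠. Let (λ(·),ω(·)) be a differentiable solution on [0,∞) of the closed-loop swing dynamics such that ω(t) → ω^∞·1_n as t → ∞. Then there exists a finite time t_0 ≥ 0 such that u_i(λ(t),ω(t),p) = 0 for all t ≥ t_0 and all i ∈ 𝔠; moreover, for each i ∈ 𝔠 there exists a finite time t_1 ≥ 0 such that ω_i(t) ∈ [ω̲_i, ω̄_i] for all t ≥ t_1. -/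
open Real BigOperators

/-- If the closed-loop trajectory converges to `ω∞·1` and
`ω∞ ∈ (ω̲_i^th, ω̄_i^th)` for each controlled bus, then all distributed
controllers become inactive in finite time, and each controlled frequency
enters the safe interval `[ω̲_i, ω̄_i]` in finite time. -/
theorem controller_finite_time_inactive
    (n m : ℕ)
    (D : Matrix (Fin m) (Fin n) ℝ)
    (Yb : Fin m → ℝ) (hYb : ∀ j, 0 < Yb j)
    (M E : Fin n → ℝ) (hM : ∀ i, 0 < M i) (hE : ∀ i, 0 < E i)
    (p : Fin n → ℝ) (C : Set (Fin n))
    (u : Fin n → (Fin m → ℝ) → (Fin n → ℝ) → (Fin n → ℝ) → ℝ)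
    (hu0 : ∀ i ∉ C, ∀ lam ω q, u i lam ω q = 0)
    (ωinf : ℝ) (hωinf : ωinf = (∑ i, p i) / (∑ i, E i))
    -- per-bus thresholds and class-K functions
    (wl wlth wuth wu : Fin n → ℝ)
    (h1 : ∀ i ∈ C, wl i < wlth i) (h2 : ∀ i ∈ C, wlth i < wuth i)
    (h3 : ∀ i ∈ C, wuth i < wu i)
    (ab al : Fin n → ℝ → ℝ)
    (habC : ∀ i ∈ C, Continuous (ab i)) (habM : ∀ i ∈ C, StrictMono (ab i))
    (hab0 : ∀ i ∈ C, ab i 0 = 0)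
    (habL : ∀ i ∈ C, ∃ K : NNReal, LipschitzWith K (ab i))
    (halC : ∀ i ∈ C, Continuous (al i)) (halM : ∀ i ∈ C, StrictMono (al i))
    (hal0 : ∀ i ∈ C, al i 0 = 0)
    (halL : ∀ i ∈ C, ∃ K : NNReal, LipschitzWith K (al i))
    -- every controlled bus uses the distributed transient frequency controller
    (hui : ∀ i ∈ C, ∀ (lam : Fin m → ℝ) (ω : Fin n → ℝ),
      u i lam ω p =
        ctrl (ab i) (al i) (wl i) (wlth i) (wuth i) (wu i) (qi D Yb E p i lam ω) (ω i))
    -- `ω∞` lies strictly inside the threshold interval of each controlled bus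
    (hωth : ∀ i ∈ C, wlth i < ωinf ∧ ωinf < wuth i)
    -- a differentiable solution of the closed-loop dynamics
    (lam : ℝ → Fin m → ℝ) (ω : ℝ → Fin n → ℝ) (ωd : ℝ → Fin n → ℝ)
    (hlam : ∀ t ≥ (0 : ℝ), HasDerivAt lam (D.mulVec (ω t)) t)
    (hω : ∀ t ≥ (0 : ℝ), ∀ k, HasDerivAt (fun s => ω s k) (ωd t k) t)
    (hdyn : ∀ t ≥ (0 : ℝ), ∀ k, M k * ωd t k =
      -E k * ω t k - (∑ j, D j k * Yb j * Real.sin (lam t j)) + p k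
        + u k (lam t) (ω t) p)
    -- the trajectory converges to the synchronous frequency
    (hconv : Filter.Tendsto (fun t => ω t) Filter.atTop (nhds (fun _ => ωinf))) :
    (∃ t0 : ℝ, 0 ≤ t0 ∧ ∀ t ≥ t0, ∀ i ∈ C, u i (lam t) (ω t) p = 0) ∧
    (∀ i ∈ C, ∃ t1 : ℝ, 0 ≤ t1 ∧ ∀ t ≥ t1, ω t i ∈ Set.Icc (wl i) (wu i)) := by
  have hev : ∀ᶠ t in Filter.atTop, ∀ i ∈ C, wlth i < ω t i ∧ ω t i < wuth i := by
    refine Filter.eventually_all.2 fun i => ?_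
    by_cases hi : i ∈ C
    · have hlim : Filter.Tendsto (fun t => ω t i) Filter.atTop (nhds ωinf) :=
        tendsto_pi_nhds.1 hconv i
      filter_upwards [hlim.eventually_const_lt (hωth i hi).1,
        hlim.eventually_lt_const (hωth i hi).2] with t hl hu _
      exact ⟨hl, hu⟩
    · exact Filter.Eventually.of_forall fun _ h => absurd h hi
  obtain ⟨T, hT⟩ := Filter.eventually_atTop.1 hev
  refine ⟨⟨max 0 T, le_max_left _ _, fun t ht i hi => ?_⟩,
    fun i hi => ⟨max 0 T, le_max_left _ _, fun t ht => ?_⟩⟩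
  · obtain ⟨hl, hu⟩ := hT t (le_of_max_le_right ht) i hi
    rw [hui i hi, ctrl, if_neg hu.not_gt, if_neg hl.not_gt]
  · obtain ⟨hl, hu⟩ := hT t (le_of_max_le_right ht) i hi
    exact ⟨((h1 i hi).trans hl).le, (hu.trans (h3 i hi)).le⟩
end

section
/- Fix i ∈ 𝔠 with thresholds ω̲_i < ω̲_i^th < ω̄_i^th < ω̄_i and Lipschitz class-K function ᾱ_i, and let (λ(·),ω(·)) be a differentiable solution on [0,∞) of the closed-loop swing dynamics with the distributed transient frequency controller such that ω_i(0) > ω̄_i. Let z_i : [0,∞) → ℝ be the (unique) solution of the scalar ODE M_i ż_i(t) = −ᾱ_i(z_i(t) − ω̄_i)/(z_i(t) − ω̄_i^th) with z_i(0) = ω_i(0). Then: (a) ω_i(t) ≤ z_i(t) for all t ≥ 0; (b) z_i(t) > ω̄_i for all t ≥ 0; (c) z_i is monotonically nonincreasing; (d) z_i(t) → ω̄_i as t → ∞. -/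
open Real BigOperators

/-- A function which, whenever it meets a barrier, has smaller derivative than the barrier,
stays below the barrier on `[0, ∞)`. -/
theorem le_barrier_of_hasDerivAt {f f' B B' : ℝ → ℝ}
    (hf : ∀ t ≥ (0 : ℝ), HasDerivAt f (f' t) t) (hB : ∀ t ≥ (0 : ℝ), HasDerivAt B (B' t) t)
    (h0 : f 0 ≤ B 0) (h : ∀ t ≥ (0 : ℝ), f t = B t → f' t < B' t) :
    ∀ t ≥ (0 : ℝ), f t ≤ B t := fun t ht =>
  image_le_of_deriv_right_lt_deriv_boundary' (a := 0) (b := t) (f' := f') (B' := B')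
    (fun x hx => (hf x hx.1).continuousAt.continuousWithinAt)
    (fun x hx => (hf x hx.1).hasDerivWithinAt) h0
    (fun x hx => (hB x hx.1).continuousAt.continuousWithinAt)
    (fun x hx => (hB x hx.1).hasDerivWithinAt) (fun x hx => h x hx.1) ⟨ht, le_rfl⟩

theorem hasDerivAt_const_mul_exp_mul (ε k t : ℝ) :
    HasDerivAt (fun s => ε * Real.exp (k * s)) (k * (ε * Real.exp (k * t))) t := by
  refine ((((hasDerivAt_id' t).const_mul k).exp).const_mul ε).congr_deriv ?_
  ring

theorem LipschitzWith.le_mul_of_map_zero {a : ℝ → ℝ} {K : NNReal} (ha : LipschitzWith K a)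
    (ha0 : a 0 = 0) {x : ℝ} (hx : 0 ≤ x) : a x ≤ K * x := by
  have h := ha.dist_le_mul x 0
  rw [Real.dist_eq, Real.dist_eq, ha0, sub_zero, sub_zero, abs_of_nonneg hx] at h
  exact (le_abs_self _).trans h

/-- Linear lower bound on the velocity field `x ↦ -a (x - w) / (x - θ) / μ` to the right of `w`. -/
theorem neg_mul_le_velocity {a : ℝ → ℝ} {K : NNReal} (ha : LipschitzWith K a) (ha0 : a 0 = 0)
    {θ w μ x : ℝ} (hθ : θ < w) (hμ : 0 < μ) (hx : w ≤ x) :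
    -(K / (w - θ) / μ * (x - w)) ≤ -(a (x - w)) / (x - θ) / μ := by
  have hd : 0 < w - θ := sub_pos.2 hθ
  have hle : a (x - w) / (x - θ) ≤ K * (x - w) / (w - θ) :=
    div_le_div₀ (mul_nonneg K.2 (sub_nonneg.2 hx)) (ha.le_mul_of_map_zero ha0 (sub_nonneg.2 hx))
      hd (by linarith)
  have h := div_le_div_of_nonneg_right hle hμ.le
  calc -(K / (w - θ) / μ * (x - w)) = -(K * (x - w) / (w - θ) / μ) := by ring
    _ ≤ -(a (x - w) / (x - θ) / μ) := neg_le_neg h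
    _ = _ := by ring

/-- One-sided Lipschitz bound on the velocity field `x ↦ -a (x - w) / (x - θ) / μ`. -/
theorem velocity_sub_le {a : ℝ → ℝ} {K : NNReal} (ha : LipschitzWith K a) (ha0 : a 0 = 0)
    (ham : Monotone a) {θ w μ x y : ℝ} (hθ : θ < w) (hμ : 0 < μ) (hx : w ≤ x) (hxy : x ≤ y) :
    -(a (y - w)) / (y - θ) / μ ≤ -(a (x - w)) / (x - θ) / μ + K / (w - θ) / μ * (y - x) := by
  have hd : 0 < w - θ := sub_pos.2 hθ
  have hxθ : 0 < x - θ := by linarith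
  have hyθ : 0 < y - θ := by linarith
  have hax : a (x - w) ≤ K * (x - θ) :=
    (ha.le_mul_of_map_zero ha0 (sub_nonneg.2 hx)).trans
      (mul_le_mul_of_nonneg_left (by linarith) K.2)
  have hay : a (x - w) / (y - θ) ≤ a (y - w) / (y - θ) :=
    div_le_div_of_nonneg_right (ham (by linarith)) hyθ.le
  have hK : a (x - w) / (x - θ) * ((y - x) / (y - θ)) ≤ K * ((y - x) / (w - θ)) :=
    mul_le_mul ((div_le_iff₀ hxθ).2 hax)
      (div_le_div_of_nonneg_left (sub_nonneg.2 hxy) hd (by linarith))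
      (div_nonneg (sub_nonneg.2 hxy) hyθ.le) K.2
  have hid : a (x - w) / (x - θ) * ((y - x) / (y - θ)) =
      a (x - w) / (x - θ) - a (x - w) / (y - θ) := by
    field_simp
    ring
  have hmain : -(a (y - w)) / (y - θ) ≤ -(a (x - w)) / (x - θ) + K / (w - θ) * (y - x) := by
    rw [neg_div, neg_div]
    have : (K : ℝ) / (w - θ) * (y - x) = K * ((y - x) / (w - θ)) := by ring
    linarith
  calc _ ≤ (-(a (x - w)) / (x - θ) + K / (w - θ) * (y - x)) / μ :=
        div_le_div_of_nonneg_right hmain hμ.le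
    _ = _ := by ring

section ScalarFlow

variable {a z : ℝ → ℝ} {K : NNReal} {θ w μ : ℝ}

theorem lt_of_hasDerivAt_velocity (ha : LipschitzWith K a) (ha0 : a 0 = 0)
    (hθ : θ < w) (hμ : 0 < μ) (h0 : w < z 0)
    (hz : ∀ t ≥ (0 : ℝ), HasDerivAt z (-(a (z t - w)) / (z t - θ) / μ) t) :
    ∀ t ≥ (0 : ℝ), w < z t := by
  intro t ht
  set c := (K : ℝ) / (w - θ) / μ with hc
  have hexp : ∀ s : ℝ, 0 < (z 0 - w) * Real.exp (-(c + 1) * s) := fun s =>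
    mul_pos (sub_pos.2 h0) (Real.exp_pos _)
  have hbar := le_barrier_of_hasDerivAt (f := fun s => -z s)
    (B := fun s => -(w + (z 0 - w) * Real.exp (-(c + 1) * s)))
    (fun s hs => (hz s hs).neg)
    (fun s _ => ((hasDerivAt_const_mul_exp_mul (z 0 - w) (-(c + 1)) s).const_add w).neg)
    (by simp) (fun s _ heq => by
      have hzs : z s = w + (z 0 - w) * Real.exp (-(c + 1) * s) := neg_injective heq
      have hv := neg_mul_le_velocity ha ha0 hθ hμ (x := z s) (by linarith [hexp s])
      rw [← hc] at hv
      have hsub : z s - w = (z 0 - w) * Real.exp (-(c + 1) * s) := by linarith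
      rw [← hsub]
      have := hexp s
      linarith) t ht
  have := hexp t
  linarith

theorem antitoneOn_of_hasDerivAt_velocity (ham : StrictMono a) (ha0 : a 0 = 0)
    (hθ : θ < w) (hμ : 0 < μ) (hw : ∀ t ≥ (0 : ℝ), w < z t)
    (hz : ∀ t ≥ (0 : ℝ), HasDerivAt z (-(a (z t - w)) / (z t - θ) / μ) t) :
    AntitoneOn z (Set.Ici 0) := by
  refine antitoneOn_of_hasDerivWithinAt_nonpos (convex_Ici 0)
    (fun t ht => (hz t ht).continuousAt.continuousWithinAt)
    (fun t ht => (hz t (interior_subset ht)).hasDerivWithinAt) fun t ht => ?_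
  have hwt := hw t (interior_subset ht)
  have hpos : 0 < a (z t - w) := ha0 ▸ ham (sub_pos.2 hwt)
  exact div_nonpos_of_nonpos_of_nonneg
    (div_nonpos_of_nonpos_of_nonneg (neg_nonpos.2 hpos.le) (by linarith)) hμ.le

theorem tendsto_of_hasDerivAt_velocity (ham : StrictMono a) (ha0 : a 0 = 0)
    (hθ : θ < w) (hμ : 0 < μ) (hw : ∀ t ≥ (0 : ℝ), w < z t)
    (hz : ∀ t ≥ (0 : ℝ), HasDerivAt z (-(a (z t - w)) / (z t - θ) / μ) t) :
    Filter.Tendsto z Filter.atTop (nhds w) := by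
  have hanti := antitoneOn_of_hasDerivAt_velocity ham ha0 hθ hμ hw hz
  have hreach : ∀ v > w, ∃ t ≥ (0 : ℝ), z t < v := by
    intro v hv
    by_contra! hge
    have hz0 : 0 < z 0 - θ := by linarith [hw 0 le_rfl]
    have hav : 0 < a (v - w) := ha0 ▸ ham (sub_pos.2 hv)
    set η := a (v - w) / (z 0 - θ) / μ with hη
    have hηpos : 0 < η := div_pos (div_pos hav hz0) hμ
    have hlin : AntitoneOn (fun t => z t + η * t) (Set.Ici 0) := by
      have hder : ∀ t ≥ (0 : ℝ), HasDerivAt (fun t => z t + η * t)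
          (-(a (z t - w)) / (z t - θ) / μ + η * 1) t := fun t ht =>
        (hz t ht).add ((hasDerivAt_id t).const_mul η)
      refine antitoneOn_of_hasDerivWithinAt_nonpos (convex_Ici 0)
        (fun t ht => (hder t ht).continuousAt.continuousWithinAt)
        (fun t ht => (hder t (interior_subset ht)).hasDerivWithinAt) fun t ht => ?_
      have ht0 : (0 : ℝ) ≤ t := interior_subset ht
      have hzt : z t ≤ z 0 := hanti (Set.mem_Ici.2 le_rfl) ht0 ht0
      have hzθ : 0 < z t - θ := by linarith [hw t ht0]
      have hmono : a (v - w) ≤ a (z t - w) := ham.monotone (by linarith [hge t ht0])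
      have hle : η ≤ a (z t - w) / (z t - θ) / μ :=
        div_le_div_of_nonneg_right
          (div_le_div₀ (hav.le.trans hmono) hmono hzθ (by linarith)) hμ.le
      rw [neg_div, neg_div]
      linarith
    have hT : 0 ≤ (z 0 - w) / η := div_nonneg (by linarith [hw 0 le_rfl]) hηpos.le
    have h := hlin (Set.mem_Ici.2 le_rfl) hT hT
    simp only [mul_zero, add_zero, mul_div_cancel₀ _ hηpos.ne'] at h
    linarith [hw _ hT]
  refine tendsto_order.2 ⟨fun v hv => ?_, fun v hv => ?_⟩
  · filter_upwards [Filter.eventually_ge_atTop 0] with t ht using hv.trans (hw t ht)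
  · obtain ⟨T, hT, hTv⟩ := hreach v hv
    filter_upwards [Filter.eventually_ge_atTop T] with t ht
    exact (hanti hT (hT.trans ht) ht).trans_lt hTv

theorem le_of_hasDerivAt_le_velocity {x x' : ℝ → ℝ} (ha : LipschitzWith K a) (ha0 : a 0 = 0)
    (ham : Monotone a) (hθ : θ < w) (hμ : 0 < μ) (hw : ∀ t ≥ (0 : ℝ), w < z t)
    (hz : ∀ t ≥ (0 : ℝ), HasDerivAt z (-(a (z t - w)) / (z t - θ) / μ) t)
    (hx : ∀ t ≥ (0 : ℝ), HasDerivAt x (x' t) t) (h0 : x 0 ≤ z 0)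
    (hx' : ∀ t ≥ (0 : ℝ), θ < x t → x' t ≤ -(a (x t - w)) / (x t - θ) / μ) :
    ∀ t ≥ (0 : ℝ), x t ≤ z t := by
  intro t ht
  set c := (K : ℝ) / (w - θ) / μ with hc
  have hbar : ∀ ε > 0, x t ≤ z t + ε * Real.exp ((c + 1) * t) := fun ε hε =>
    le_barrier_of_hasDerivAt (B := fun s => z s + ε * Real.exp ((c + 1) * s)) hx
      (fun s hs => (hz s hs).add (hasDerivAt_const_mul_exp_mul ε (c + 1) s))
      (by simp only [mul_zero, Real.exp_zero]; linarith) (fun s hs heq => by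
        have hpos : 0 < ε * Real.exp ((c + 1) * s) := mul_pos hε (Real.exp_pos _)
        have hws := hw s hs
        have hv := velocity_sub_le ha ha0 ham hθ hμ hws.le (y := x s) (by linarith)
        rw [← hc] at hv
        have hsub : x s - z s = ε * Real.exp ((c + 1) * s) := by linarith
        rw [hsub] at hv
        have := hx' s hs (by linarith)
        linarith) t ht
  refine le_of_forall_pos_le_add fun δ hδ => ?_
  have h := hbar (δ / Real.exp ((c + 1) * t)) (div_pos hδ (Real.exp_pos _))
  rwa [div_mul_cancel₀ _ (Real.exp_pos _).ne'] at h

end ScalarFlow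

theorem ctrl_le (ab al : ℝ → ℝ) {wl wlth wuth wu q x : ℝ} (h : wuth < x) :
    ctrl ab al wl wlth wuth wu q x ≤ -(ab (x - wu)) / (x - wuth) + q := by
  rw [ctrl, if_pos h]
  exact min_le_right _ _

/-- Upper bound on the frequency evolution: if `ω_i(0) > ω̄_i`, the solution
`z_i` of `M_i ż = −ᾱ_i(z−ω̄_i)/(z−ω̄_i^th)`, `z(0)=ω_i(0)`, upper-bounds
`ω_i(t)`; moreover `z_i` stays above `ω̄_i`, is monotonically nonincreasing,
and converges to `ω̄_i`. -/
theorem comparison_upper_bound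
    (n m : ℕ)
    (D : Matrix (Fin m) (Fin n) ℝ)
    (Yb : Fin m → ℝ) (hYb : ∀ j, 0 < Yb j)
    (M E : Fin n → ℝ) (hM : ∀ i, 0 < M i) (hE : ∀ i, 0 < E i)
    (p : Fin n → ℝ) (C : Set (Fin n))
    (u : Fin n → (Fin m → ℝ) → (Fin n → ℝ) → (Fin n → ℝ) → ℝ)
    (hu0 : ∀ i ∉ C, ∀ lam ω q, u i lam ω q = 0)
    (i : Fin n) (hiC : i ∈ C)
    (wl wlth wuth wu : ℝ) (h1 : wl < wlth) (h2 : wlth < wuth) (h3 : wuth < wu)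
    -- Lipschitz class-K functions
    (ab al : ℝ → ℝ)
    (habC : Continuous ab) (habM : StrictMono ab) (hab0 : ab 0 = 0)
    (habL : ∃ K : NNReal, LipschitzWith K ab)
    (halC : Continuous al) (halM : StrictMono al) (hal0 : al 0 = 0)
    (halL : ∃ K : NNReal, LipschitzWith K al)
    -- bus `i` uses the distributed transient frequency controller
    (hui : ∀ (lam : Fin m → ℝ) (ω : Fin n → ℝ),
      u i lam ω p = ctrl ab al wl wlth wuth wu (qi D Yb E p i lam ω) (ω i))
    -- a differentiable solution of the closed-loop dynamics
    (lam : ℝ → Fin m → ℝ) (ω : ℝ → Fin n → ℝ) (ωd : ℝ → Fin n → ℝ)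
    (hlam : ∀ t ≥ (0 : ℝ), HasDerivAt lam (D.mulVec (ω t)) t)
    (hω : ∀ t ≥ (0 : ℝ), ∀ k, HasDerivAt (fun s => ω s k) (ωd t k) t)
    (hdyn : ∀ t ≥ (0 : ℝ), ∀ k, M k * ωd t k =
      -E k * ω t k - (∑ j, D j k * Yb j * Real.sin (lam t j)) + p k
        + u k (lam t) (ω t) p)
    -- the initial frequency exceeds the upper safe bound
    (h0 : wu < ω 0 i)
    -- the comparison trajectory
    (z : ℝ → ℝ) (hz0 : z 0 = ω 0 i)
    (hz : ∀ t ≥ (0 : ℝ), HasDerivAt z (-(ab (z t - wu)) / (z t - wuth) / M i) t) :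
    (∀ t ≥ (0 : ℝ), ω t i ≤ z t) ∧
    (∀ t ≥ (0 : ℝ), wu < z t) ∧
    AntitoneOn z (Set.Ici (0 : ℝ)) ∧
    Filter.Tendsto z Filter.atTop (nhds wu) := by
  obtain ⟨K, hK⟩ := habL
  have hw := lt_of_hasDerivAt_velocity hK hab0 h3 (hM i) (hz0 ▸ h0) hz
  refine ⟨?_, hw, antitoneOn_of_hasDerivAt_velocity habM hab0 h3 (hM i) hw hz,
    tendsto_of_hasDerivAt_velocity habM hab0 h3 (hM i) hw hz⟩
  refine le_of_hasDerivAt_le_velocity hK hab0 habM.monotone h3 (hM i) hw hz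
    (fun t ht => hω t ht i) hz0.ge fun t ht hth => ?_
  have hd := hdyn t ht i
  have hc := ctrl_le ab al (wl := wl) (wlth := wlth) (wu := wu)
    (q := qi D Yb E p i (lam t) (ω t)) hth
  rw [hui] at hd
  rw [le_div_iff₀ (hM i), mul_comm]
  simp only [qi] at hc hd
  linarith
end

section
/- Let M_i > 0, γ̄_i > 0, and ω̄_i^th < ω̄_i < ω_i(0), and let z_i : [0,∞) → ℝ be the solution of M_i ż_i(t) = −γ̄_i(z_i(t) − ω̄_i)/(z_i(t) − ω̄_i^th) with z_i(0) = ω_i(0), which satisfies z_i(t) > ω̄_i for all t ≥ 0. Then for every t ≥ 0: (a) z_i(t) + (ω̄_i − ω̄_i^th)·ln((z_i(t) − ω̄_i)/(ω_i(0) − ω̄_i)) = −γ̄_i t / M_i + ω_i(0); and (b) z_i(t) ≤ ω̄_i + (ω_i(0) − ω̄_i)·exp((−γ̄_i t / M_i + ω_i(0) − ω̄_i)/(ω̄_i − ω̄_i^th)). -/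
open Real

/-- Explicit characterization and exponential bound for the comparison
trajectory `z_i` of `M_i ż = −γ̄_i(z−ω̄_i)/(z−ω̄_i^th)` with linear class-K
function and `z(0) = ω_i(0) > ω̄_i`. -/
theorem comparison_trajectory_formula
    (Mi γ wuth wu w0 : ℝ) (hM : 0 < Mi) (hγ : 0 < γ)
    (h1 : wuth < wu) (h2 : wu < w0)
    (z : ℝ → ℝ) (hz0 : z 0 = w0)
    (hz : ∀ t ≥ (0 : ℝ), HasDerivAt z (-(γ * (z t - wu)) / (z t - wuth) / Mi) t)
    (hzpos : ∀ t ≥ (0 : ℝ), wu < z t) :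
    ∀ t ≥ (0 : ℝ),
      z t + (wu - wuth) * Real.log ((z t - wu) / (w0 - wu))
        = -γ * t / Mi + w0
      ∧ z t ≤ wu + (w0 - wu) * Real.exp ((-γ * t / Mi + w0 - wu) / (wu - wuth)) := by
  have hc : 0 < wu - wuth := sub_pos.2 h1
  have hd : 0 < w0 - wu := sub_pos.2 h2
  have hderiv : ∀ s ≥ (0 : ℝ), HasDerivAt
      (fun s => z s + (wu - wuth) * Real.log ((z s - wu) / (w0 - wu)) + γ / Mi * s) 0 s := by
    intro s hs
    have hpos : 0 < z s - wu := sub_pos.2 (hzpos s hs)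
    have hpos' : 0 < z s - wuth := by linarith
    have hlog := (((hz s hs).sub_const wu).div_const (w0 - wu)).log (div_pos hpos hd).ne'
    refine (((hz s hs).add (hlog.const_mul (wu - wuth))).add
      ((hasDerivAt_id s).const_mul (γ / Mi))).congr_deriv ?_
    field_simp
    ring
  intro t ht
  have hformula : z t + (wu - wuth) * Real.log ((z t - wu) / (w0 - wu))
      = -γ * t / Mi + w0 := by
    have hconst := constant_of_has_deriv_right_zero (a := 0) (b := t)
      (fun s hs => (hderiv s hs.1).continuousAt.continuousWithinAt)
      (fun s hs => (hderiv s hs.1).hasDerivWithinAt) t ⟨ht, le_rfl⟩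
    simp only [hz0, div_self hd.ne', Real.log_one, mul_zero, add_zero] at hconst
    linear_combination hconst
  refine ⟨hformula, ?_⟩
  have hpos : 0 < (z t - wu) / (w0 - wu) := div_pos (sub_pos.2 (hzpos t ht)) hd
  have hlog : Real.log ((z t - wu) / (w0 - wu))
      ≤ (-γ * t / Mi + w0 - wu) / (wu - wuth) := by
    rw [le_div_iff₀ hc]
    linarith [hzpos t ht]
  have hexp := (Real.log_le_iff_le_exp hpos).1 hlog
  rw [div_le_iff₀ hd] at hexp
  linarith
end
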